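/- arXiv:1708.07680 — 2 statements merged into one kernel-verified Lean document; each statement's English description precedes it below -/
import Mathlib

section
/- Let c = 1. There are exactly six Inc(ℕ)-compatible term orders on R, namely (writing A := {j | a_j ≠ b_j} for monomials x^a ≠ x^b): (i) ≺_min: x^a ≺ x^b ⇔ a_{min(A)} < b_{min(A)}; (ii) ≺_deg-min: x^a ≺ x^b ⇔ deg(x^a) < deg(x^b), or degrees equal and a_{min(A)} < b_{min(A)}; (iii) (≺_revdeg-min)⁻¹: x^a ≺ x^b ⇔ deg(x^a) < deg(x^b), or degrees equal and a_{min(A)} > b_{min(A)}; (iv) ≺_{max,1}: x^a ≺ x^b ⇔ a_{max(A)} < b_{max(A)}; (v) ≺_{deg-max,2}: x^a ≺ x^b ⇔ deg(x^a) < deg(x^b), or degrees equal and a_{max(A)} < b_{max(A)}; (vi) (≺_{revdeg-max,2})⁻¹: x^a ≺ x^b ⇔ deg(x^a) < deg(x^b), or degrees equal and a_{max(A)} > b_{max(A)}. -/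
/-- A term order: a total order on monomials (identified with their exponent vectors, so
that multiplication of monomials becomes addition of exponent vectors) which respects
multiplication and has the monomial `1` (exponent vector `0`) as least element. -/
structure TermOrder (σ : Type*) where
  le : (σ →₀ ℕ) → (σ →₀ ℕ) → Prop
  refl : ∀ a, le a a
  trans : ∀ a b c, le a b → le b c → le a c
  antisymm : ∀ a b, le a b → le b a → a = b
  total : ∀ a b, le a b ∨ le b a
  add_right : ∀ a b h, le a b → le (a + h) (b + h)
  zero_le : ∀ a, le 0 a

/-- A term order on `R = K[x_j | j ∈ ℕ]` (monomials being exponent vectors in `ℕ →₀ ℕ`)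
is `Inc(ℕ)`-compatible if it is preserved by shifting variable indices along every
strictly increasing map. -/
def IncCompatible (T : TermOrder ℕ) : Prop :=
  ∀ p : ℕ → ℕ, StrictMono p → ∀ a b, T.le a b →
    T.le (Finsupp.mapDomain p a) (Finsupp.mapDomain p b)

/-- The degree of a monomial. -/
def degOf (a : ℕ →₀ ℕ) : ℕ := a.sum fun _ e => e

/-- `a_{min A} < b_{min A}` where `A = {j | a_j ≠ b_j}`: there is `j` with `a_j < b_j` such
that `a` and `b` agree below `j`. -/
def minLt (a b : ℕ →₀ ℕ) : Prop := ∃ j : ℕ, a j < b j ∧ ∀ k < j, a k = b k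

/-- `a_{max A} < b_{max A}` where `A = {j | a_j ≠ b_j}`: there is `j` with `a_j < b_j` such
that `a` and `b` agree above `j`. -/
def maxLt (a b : ℕ →₀ ℕ) : Prop := ∃ j : ℕ, a j < b j ∧ ∀ k, j < k → a k = b k

/-- (i) `≺_min`. -/
def oMin (a b : ℕ →₀ ℕ) : Prop := minLt a b

/-- (ii) `≺_deg-min`. -/
def oDegMin (a b : ℕ →₀ ℕ) : Prop :=
  degOf a < degOf b ∨ (degOf a = degOf b ∧ minLt a b)

/-- (iii) `(≺_revdeg-min)⁻¹`. -/
def oRevDegMinInv (a b : ℕ →₀ ℕ) : Prop :=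
  degOf a < degOf b ∨ (degOf a = degOf b ∧ minLt b a)

/-- (iv) `≺_{max,1}`. -/
def oMax (a b : ℕ →₀ ℕ) : Prop := maxLt a b

/-- (v) `≺_{deg-max,2}`. -/
def oDegMax (a b : ℕ →₀ ℕ) : Prop :=
  degOf a < degOf b ∨ (degOf a = degOf b ∧ maxLt a b)

/-- (vi) `(≺_{revdeg-max,2})⁻¹`. -/
def oRevDegMaxInv (a b : ℕ →₀ ℕ) : Prop :=
  degOf a < degOf b ∨ (degOf a = degOf b ∧ maxLt b a)

section Infinitesimal

variable {G : Type*} [AddCommGroup G] [LinearOrder G] [IsOrderedAddMonoid G]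

/-- The elements of an ordered group that are infinitesimal relative to the positive
element `g`. -/
def infinitesimals (g : G) (hg : 0 < g) : AddSubgroup G where
  carrier := {v | ∀ n : ℕ, n • |v| < g}
  zero_mem' := by simpa using hg
  neg_mem' := by simp
  add_mem' := by
    intro v w hv hw n
    have key : ∀ u : G, |v| ≤ |u| → |w| ≤ |u| → (∀ n : ℕ, n • |u| < g) → n • |v + w| < g := by
      intro u hvu hwu hu
      calc n • |v + w| ≤ n • (|u| + |u|) :=
            nsmul_le_nsmul_right ((abs_add_le v w).trans (add_le_add hvu hwu)) n
        _ = (n + n) • |u| := by module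
        _ < g := hu _
    rcases le_total |v| |w| with h | h
    · exact key w h le_rfl hw
    · exact key v le_rfl h hv

lemma mem_infinitesimals {g : G} {hg : 0 < g} {v : G} :
    v ∈ infinitesimals g hg ↔ ∀ n : ℕ, n • |v| < g := Iff.rfl

lemma pos_of_sub_zsmul_mem {g : G} {hg : 0 < g} {v : G} {c : ℤ} (hc : 0 < c)
    (h : v - c • g ∈ infinitesimals g hg) : 0 < v := by
  have h1 : |v - c • g| < g := by simpa using h 1
  have h2 : (1 : ℤ) • g ≤ c • g := zsmul_le_zsmul_left hg.le hc
  have h3 := (abs_lt.1 h1).1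
  rw [one_zsmul] at h2
  have : c • g - g < v := by
    have := add_lt_add_left h3 (c • g)
    simpa [sub_eq_add_neg, add_comm] using this
  exact (sub_nonneg.2 h2).trans_lt this

end Infinitesimal

section TopLt

variable {G : Type*} [LinearOrder G]

/-- Where `x` orders the variables: the exponent vectors `a` and `b` differ, and at the
`x`-largest index where they differ the exponent of `a` is the smaller one. -/
def topLt (x : ℕ → G) (a b : ℕ →₀ ℕ) : Prop := ∃ j, a j < b j ∧ ∀ k, x j < x k → a k = b k

lemma topLt_of_strictMono {x : ℕ → G} (hx : StrictMono x) : topLt x = maxLt := by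
  ext a b
  simp [topLt, maxLt, hx.lt_iff_lt]

lemma topLt_of_strictAnti {x : ℕ → G} (hx : StrictAnti x) : topLt x = minLt := by
  ext a b
  simp [topLt, minLt, hx.lt_iff_gt]

end TopLt

/-- A strict total order on exponent vectors that respects addition and is preserved by
shifting indices along strictly increasing maps. -/
structure IsIncOrder (L : (ℕ →₀ ℕ) → (ℕ →₀ ℕ) → Prop) : Prop where
  irrefl : ∀ a, ¬ L a a
  trans : ∀ a b c, L a b → L b c → L a c
  total : ∀ a b, a ≠ b → L a b ∨ L b a
  add_right : ∀ a b h, L a b → L (a + h) (b + h)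
  map : ∀ p : ℕ → ℕ, StrictMono p → ∀ a b, L a b →
    L (Finsupp.mapDomain p a) (Finsupp.mapDomain p b)

/-- Refinement of the comparison of degrees by `L`. -/
def degThen (L : (ℕ →₀ ℕ) → (ℕ →₀ ℕ) → Prop) (a b : ℕ →₀ ℕ) : Prop :=
  degOf a < degOf b ∨ (degOf a = degOf b ∧ L a b)

lemma degOf_eq_degree (a : ℕ →₀ ℕ) : degOf a = a.degree := rfl

lemma degOf_add (a b : ℕ →₀ ℕ) : degOf (a + b) = degOf a + degOf b := by
  simp [degOf_eq_degree]

lemma degOf_mapDomain (p : ℕ → ℕ) (a : ℕ →₀ ℕ) : degOf (Finsupp.mapDomain p a) = degOf a := by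
  unfold degOf
  rw [Finsupp.sum_mapDomain_index (by simp) (by simp)]

lemma degOf_pos {a : ℕ →₀ ℕ} (h : a ≠ 0) : 0 < degOf a := by
  rw [degOf_eq_degree, Nat.pos_iff_ne_zero, Ne, Finsupp.degree_eq_zero_iff]
  exact h

namespace IsIncOrder

variable {L : (ℕ →₀ ℕ) → (ℕ →₀ ℕ) → Prop}

lemma asymm (hL : IsIncOrder L) {a b : ℕ →₀ ℕ} (h : L a b) : ¬ L b a :=
  fun h' => hL.irrefl a (hL.trans a b a h h')

lemma swap (hL : IsIncOrder L) : IsIncOrder fun a b => L b a where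
  irrefl := hL.irrefl
  trans a b c h h' := hL.trans c b a h' h
  total a b h := (hL.total a b h).symm
  add_right a b := hL.add_right b a
  map p hp a b := hL.map p hp b a

lemma degThen (hL : IsIncOrder L) : IsIncOrder (degThen L) where
  irrefl a := by simp [_root_.degThen, hL.irrefl]
  trans a b c := by
    rintro (h | ⟨h, h1⟩) (h' | ⟨h', h2⟩)
    · exact .inl (h.trans h')
    · exact .inl (h' ▸ h)
    · exact .inl (h ▸ h')
    · exact .inr ⟨h.trans h', hL.trans a b c h1 h2⟩
  total a b hab := by
    rcases lt_trichotomy (degOf a) (degOf b) with h | h | h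
    · exact .inl (.inl h)
    · exact (hL.total a b hab).imp (fun h' => .inr ⟨h, h'⟩) fun h' => .inr ⟨h.symm, h'⟩
    · exact .inr (.inl h)
  add_right a b h := by
    rintro (h' | ⟨h', h''⟩)
    · left; simpa [degOf_add] using h'
    · right; exact ⟨by simpa [degOf_add] using h', hL.add_right a b h h''⟩
  map p hp a b := by
    rintro (h' | ⟨h', h''⟩)
    · left; simpa [degOf_mapDomain] using h'
    · right; exact ⟨by simpa [degOf_mapDomain] using h', hL.map p hp a b h''⟩

lemma exists_termOrder (hL : IsIncOrder L) (h0 : ∀ a, a ≠ 0 → L 0 a) :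
    ∃ T : TermOrder ℕ, IncCompatible T ∧ (fun a b => T.le a b ∧ a ≠ b) = L := by
  refine ⟨{ le := fun a b => L a b ∨ a = b
            refl := fun a => .inr rfl
            trans := ?_
            antisymm := ?_
            total := ?_
            add_right := ?_
            zero_le := ?_ }, ?_, ?_⟩
  · rintro a b c (h | rfl) (h' | rfl)
    · exact .inl (hL.trans a b c h h')
    · exact .inl h
    · exact .inl h'
    · exact .inr rfl
  · rintro a b (h | h) (h' | h')
    · exact (hL.asymm h h').elim
    · exact h'.symm
    · exact h
    · exact h
  · intro a b
    by_cases h : a = b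
    · exact .inl (.inr h)
    · exact (hL.total a b h).imp .inl .inl
  · rintro a b h (h' | rfl)
    · exact .inl (hL.add_right a b h h')
    · exact .inr rfl
  · intro a
    by_cases h : a = 0
    · exact .inr h.symm
    · exact .inl (h0 a h)
  · rintro p hp a b (h | rfl)
    · exact .inl (hL.map p hp a b h)
    · exact .inr rfl
  · ext a b
    constructor
    · rintro ⟨h | h, h'⟩
      · exact h
      · exact (h' h).elim
    · rintro h
      exact ⟨.inl h, fun h' => hL.irrefl a (by simpa [h'] using h)⟩

lemma exists_termOrder_degThen (hL : IsIncOrder L) :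
    ∃ T : TermOrder ℕ, IncCompatible T ∧ (fun a b => T.le a b ∧ a ≠ b) = _root_.degThen L :=
  hL.degThen.exists_termOrder fun _ ha => .inl (by simpa [degOf] using degOf_pos ha)

/-- An asymmetric relation containing a total strict order equals it. -/
lemma eq_of_imp {L' : (ℕ →₀ ℕ) → (ℕ →₀ ℕ) → Prop} (hL : IsIncOrder L)
    (irrefl : ∀ a, ¬ L' a a) (asymm : ∀ a b, L' a b → ¬ L' b a)
    (h : ∀ a b, L a b → L' a b) : L' = L := by
  ext a b
  refine ⟨fun hab => ?_, h a b⟩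
  rcases hL.total a b (fun e => irrefl a (by simpa [← e] using hab)) with h' | h'
  · exact h'
  · exact (asymm a b hab (h b a h')).elim

end IsIncOrder

lemma isIncOrder_topLt {G : Type*} [LinearOrder G] {x : ℕ → G} (hx : Function.Injective x)
    (hp : ∀ p : ℕ → ℕ, StrictMono p → ∀ i j, x (p i) < x (p j) → x i < x j) :
    IsIncOrder (topLt x) where
  irrefl a := by simp [topLt]
  trans a b c := by
    rintro ⟨i, hi, hi'⟩ ⟨j, hj, hj'⟩
    rcases lt_trichotomy (x i) (x j) with h | h | h
    · exact ⟨j, hi' j h ▸ hj, fun k hk => (hi' k (h.trans hk)).trans (hj' k hk)⟩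
    · obtain rfl := hx h
      exact ⟨i, hi.trans hj, fun k hk => (hi' k hk).trans (hj' k hk)⟩
    · exact ⟨i, hj' i h ▸ hi, fun k hk => (hi' k hk).trans (hj' k (h.trans hk))⟩
  total a b hab := by
    obtain ⟨j, hj⟩ : ∃ j, a j ≠ b j := by
      by_contra! h
      exact hab (Finsupp.ext h)
    have hmem : ∀ k, k ∈ (a.support ∪ b.support).filter (fun i => a i ≠ b i) ↔ a k ≠ b k := by
      intro k
      simp only [Finset.mem_filter, Finset.mem_union, Finsupp.mem_support_iff]
      omega
    obtain ⟨m, hm, hmax⟩ := Finset.exists_max_image _ x ⟨j, (hmem j).2 hj⟩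
    rw [hmem] at hm
    have hk : ∀ k, x m < x k → a k = b k := fun k hk => by
      by_contra h
      exact (hmax k ((hmem k).2 h)).not_gt hk
    rcases lt_or_gt_of_ne hm with h | h
    · exact .inl ⟨m, h, hk⟩
    · exact .inr ⟨m, h, fun k h => (hk k h).symm⟩
  add_right a b h := by
    rintro ⟨j, hj, hk⟩
    exact ⟨j, by simpa using hj, fun k hjk => by simp [hk k hjk]⟩
  map p hpm a b := by
    rintro ⟨j, hj, hk⟩
    refine ⟨p j, by simpa [Finsupp.mapDomain_apply hpm.injective] using hj, fun k hjk => ?_⟩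
    by_cases hr : k ∈ Set.range p
    · obtain ⟨k, rfl⟩ := hr
      simp only [Finsupp.mapDomain_apply hpm.injective]
      exact hk k (hp p hpm _ _ hjk)
    · rw [Finsupp.mapDomain_of_notMem_range _ _ hr, Finsupp.mapDomain_of_notMem_range _ _ hr]

lemma isIncOrder_maxLt : IsIncOrder maxLt := by
  rw [← topLt_of_strictMono (x := (id : ℕ → ℕ)) strictMono_id]
  exact isIncOrder_topLt Function.injective_id fun p hp i j h => hp.lt_iff_lt.1 h

lemma isIncOrder_minLt : IsIncOrder minLt := by
  rw [← topLt_of_strictAnti (x := OrderDual.toDual) fun i j h => h]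
  exact isIncOrder_topLt OrderDual.toDual.injective fun p hp i j h => hp.lt_iff_lt.1 h

section Representation

/-- The exponent vectors, ordered by a given term order. -/
def TermOrder.Monomial {σ : Type*} (_T : TermOrder σ) : Type _ := σ →₀ ℕ

noncomputable instance {σ : Type*} (T : TermOrder σ) : AddCommMonoid T.Monomial :=
  inferInstanceAs (AddCommMonoid (σ →₀ ℕ))

open Classical in
noncomputable instance {σ : Type*} (T : TermOrder σ) : LinearOrder T.Monomial where
  le := T.le
  le_refl := T.refl
  le_trans := T.trans
  le_antisymm := T.antisymm
  le_total := T.total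
  toDecidableLE := inferInstance

lemma TermOrder.le_of_add_le_add_right {σ : Type*} (T : TermOrder σ) {a b h : σ →₀ ℕ}
    (hab : T.le (a + h) (b + h)) : T.le a b := by
  rcases T.total a b with h' | h'
  · exact h'
  · rw [add_right_cancel (T.antisymm _ _ hab (T.add_right b a h h'))]
    exact T.refl b

instance {σ : Type*} (T : TermOrder σ) : IsOrderedCancelAddMonoid T.Monomial where
  add_le_add_left a b hab h := T.add_right a b h hab
  le_of_add_le_add_left a b c h := by
    rw [add_comm a, add_comm a] at h
    exact T.le_of_add_le_add_right h

/-- Every term order comes from an assignment of elements of an ordered group to the variables. -/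
lemma TermOrder.exists_weights {σ : Type} (T : TermOrder σ) :
    ∃ (G : Type) (_ : AddCommGroup G) (_ : LinearOrder G) (_ : IsOrderedAddMonoid G) (x : σ → G),
      ∀ a b, T.le a b ↔ Finsupp.linearCombination ℕ x a ≤ Finsupp.linearCombination ℕ x b := by
  let f : (σ →₀ ℕ) →+ Algebra.GrothendieckAddGroup T.Monomial :=
    Algebra.GrothendieckAddGroup.of (M := T.Monomial)
  refine ⟨Algebra.GrothendieckAddGroup T.Monomial, inferInstance, inferInstance, inferInstance,
    fun i => f (Finsupp.single i 1), fun a b => ?_⟩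
  have hf : ∀ a, Finsupp.linearCombination ℕ (fun i => f (Finsupp.single i 1)) a = f a := by
    intro a
    have : (Finsupp.linearCombination ℕ fun i => f (Finsupp.single i 1)).toAddMonoidHom = f := by
      ext i
      simp
    exact DFunLike.congr_fun this a
  rw [hf, hf]
  exact ((AddLocalization.mkOrderEmbedding (α := T.Monomial) (s := ⊤) 0).le_iff_le
    (a := a) (b := b)).symm

end Representation

section Weights

lemma linearCombination_sub_linearCombination {G : Type*} [AddCommGroup G] {x : ℕ → G}
    {a b : ℕ →₀ ℕ} {s : Finset ℕ}
    (ha : a.support ⊆ s) (hb : b.support ⊆ s) :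
    Finsupp.linearCombination ℕ x b - Finsupp.linearCombination ℕ x a =
      ∑ i ∈ s, ((b i : ℤ) - a i) • x i := by
  rw [Finsupp.linearCombination_apply, Finsupp.linearCombination_apply,
    Finsupp.sum_of_support_subset _ hb _ (by simp), Finsupp.sum_of_support_subset _ ha _ (by simp),
    ← Finset.sum_sub_distrib]
  exact Finset.sum_congr rfl fun i _ => by simp [sub_smul]

lemma degOf_sub_degOf {a b : ℕ →₀ ℕ} {s : Finset ℕ}
    (ha : a.support ⊆ s) (hb : b.support ⊆ s) :
    (degOf b : ℤ) - degOf a = ∑ i ∈ s, ((b i : ℤ) - a i) := by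
  rw [degOf, degOf, Finsupp.sum_of_support_subset _ hb _ (by simp),
    Finsupp.sum_of_support_subset _ ha _ (by simp), Finset.sum_sub_distrib]
  push_cast
  rfl

lemma linearCombination_neg {G : Type*} [AddCommGroup G] {x : ℕ → G} (a : ℕ →₀ ℕ) :
    Finsupp.linearCombination ℕ (-x) a = -Finsupp.linearCombination ℕ x a := by
  simp [Finsupp.linearCombination_apply, Finsupp.sum, Finset.sum_neg_distrib]

variable {G : Type*} [AddCommGroup G] [LinearOrder G] [IsOrderedAddMonoid G] {x : ℕ → G}

/-- If each variable dominates all multiples of the smaller ones, the order is lexicographic. -/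
lemma linearCombination_lt_of_topLt (hx : Function.Injective x) (hpos : ∀ i, 0 < x i)
    (h : ∀ i j, x i < x j → ∀ n : ℕ, n • x i < x j) {a b : ℕ →₀ ℕ} (hab : topLt x a b) :
    Finsupp.linearCombination ℕ x a < Finsupp.linearCombination ℕ x b := by
  obtain ⟨j, hj, hk⟩ := hab
  have hjs : j ∈ insert j (a.support ∪ b.support) := Finset.mem_insert_self _ _
  rw [← sub_pos, linearCombination_sub_linearCombination (s := insert j (a.support ∪ b.support))
    (by grind) (by grind)]
  refine pos_of_sub_zsmul_mem (g := x j) (hg := hpos j) (c := (b j : ℤ) - a j) (by omega) ?_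
  rw [← Finset.add_sum_erase _ _ hjs, add_sub_cancel_left]
  refine AddSubgroup.sum_mem _ fun i hi => ?_
  rcases lt_trichotomy (x i) (x j) with hij | hij | hij
  · exact AddSubgroup.zsmul_mem _
      (by simpa [mem_infinitesimals, abs_of_pos (hpos i)] using h i j hij) _
  · exact absurd (hx hij) (Finset.ne_of_mem_erase hi)
  · simp [hk i hij]

/-- If the variables agree up to infinitesimals, the order compares degrees first. -/
lemma linearCombination_lt_of_degOf_lt (hpos : ∀ i, 0 < x i)
    (h : ∀ i j k, ∀ n : ℕ, n • |x i - x j| < x k) {a b : ℕ →₀ ℕ} (hab : degOf a < degOf b) :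
    Finsupp.linearCombination ℕ x a < Finsupp.linearCombination ℕ x b := by
  have ha : a.support ⊆ a.support ∪ b.support := Finset.subset_union_left
  have hb : b.support ⊆ a.support ∪ b.support := Finset.subset_union_right
  rw [← sub_pos, linearCombination_sub_linearCombination ha hb]
  refine pos_of_sub_zsmul_mem (g := x 0) (hg := hpos 0) (c := (degOf b : ℤ) - degOf a)
    (by omega) ?_
  rw [degOf_sub_degOf ha hb, Finset.sum_smul, ← Finset.sum_sub_distrib]
  refine AddSubgroup.sum_mem _ fun i hi => ?_
  rw [← smul_sub]
  exact AddSubgroup.zsmul_mem _ (mem_infinitesimals.2 (h i 0 0)) _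

/-- If larger gaps between variables dominate smaller ones, vectors of equal degree are compared
by their largest differing index. -/
lemma linearCombination_lt_of_degOf_eq_of_topLt (hx : Function.Injective x)
    (h : ∀ i j k, x i < x j → x j < x k → ∀ n : ℕ, n • (x j - x i) < x k - x j)
    {a b : ℕ →₀ ℕ} (hdeg : degOf a = degOf b) (hab : topLt x a b) :
    Finsupp.linearCombination ℕ x a < Finsupp.linearCombination ℕ x b := by
  obtain ⟨j, hj, hk⟩ := hab
  set s := insert j (a.support ∪ b.support) with hs
  have hjs : j ∈ s := Finset.mem_insert_self _ _
  have ha : a.support ⊆ s := by grind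
  have hb : b.support ⊆ s := by grind
  have hsum : ∑ i ∈ s, ((b i : ℤ) - a i) = 0 := by
    rw [← degOf_sub_degOf ha hb, hdeg, sub_self]
  obtain ⟨h0, hh0, hmax⟩ := Finset.exists_max_image (s.filter fun i => i ≠ j ∧ a i ≠ b i) x (by
    by_contra hempty
    rw [Finset.not_nonempty_iff_eq_empty, Finset.filter_eq_empty_iff] at hempty
    rw [Finset.sum_eq_single_of_mem j hjs fun i hi hij => ?_] at hsum
    · omega
    · have := hempty hi
      simp only [hij, ne_eq, not_false_eq_true, true_and, not_not] at this
      simp [this])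
  rw [Finset.mem_filter] at hh0
  have hlt : ∀ i, i ≠ j → a i ≠ b i → x i < x j := fun i hij hi =>
    lt_of_le_of_ne (not_lt.1 fun hji => hi (hk i hji)) fun e => hij (hx e)
  have hg := hlt h0 hh0.2.1 hh0.2.2
  rw [← sub_pos, linearCombination_sub_linearCombination ha hb]
  have hshift : ∑ i ∈ s, ((b i : ℤ) - a i) • x i = ∑ i ∈ s, ((b i : ℤ) - a i) • (x i - x h0) := by
    simp_rw [smul_sub]
    rw [Finset.sum_sub_distrib, ← Finset.sum_smul, hsum, zero_smul, sub_zero]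
  rw [hshift]
  refine pos_of_sub_zsmul_mem (g := x j - x h0) (hg := sub_pos.2 hg) (c := (b j : ℤ) - a j)
    (by omega) ?_
  rw [← Finset.add_sum_erase _ _ hjs, add_sub_cancel_left]
  refine AddSubgroup.sum_mem _ fun i hi => ?_
  by_cases hab : a i = b i
  · simp [hab]
  have hij := Finset.ne_of_mem_erase hi
  rcases (hmax i (Finset.mem_filter.2 ⟨Finset.mem_of_mem_erase hi, hij, hab⟩)).eq_or_lt with e | e
  · simp [e]
  · refine AddSubgroup.zsmul_mem _ ?_ _
    rw [mem_infinitesimals, abs_sub_comm, abs_of_pos (sub_pos.2 e)]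
    exact h i h0 j e hg

lemma linearCombination_lt_of_degOf_eq_of_topLt_neg (hx : Function.Injective x)
    (h : ∀ i j k, x i < x j → x j < x k → ∀ n : ℕ, n • (x k - x j) < x j - x i)
    {a b : ℕ →₀ ℕ} (hdeg : degOf a = degOf b) (hab : topLt (-x) b a) :
    Finsupp.linearCombination ℕ x a < Finsupp.linearCombination ℕ x b := by
  have := linearCombination_lt_of_degOf_eq_of_topLt (x := -x) (neg_injective.comp hx)
    (fun i j k hij hjk n => by
      have := h k j i (by simpa using hjk) (by simpa using hij) n
      simpa [sub_eq_add_neg, add_comm] using this) hdeg.symm hab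
  simpa [linearCombination_neg] using this

end Weights

section Dichotomies

variable {G : Type*} [AddCommGroup G] [LinearOrder G] [IsOrderedAddMonoid G] {x : ℕ → G}

/-- The sign of an integer combination of three variables depends only on their relative order. -/
def SignInvariant (x : ℕ → G) : Prop :=
  ∀ (α β γ : ℤ) (i j k r s t : ℕ), x i < x j → x j < x k → x r < x s → x s < x t →
    0 ≤ α • x i + β • x j + γ • x k → 0 ≤ α • x r + β • x s + γ • x t

/-- The variables are ordered increasingly or decreasingly. -/
def Monotonic {G : Type*} [LinearOrder G] (x : ℕ → G) : Prop := StrictMono x ∨ StrictAnti x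

lemma exists_strictMono_extending {i j k : ℕ} (hij : i < j) (hjk : j < k) :
    ∃ p : ℕ → ℕ, StrictMono p ∧ p 0 = i ∧ p 1 = j ∧ p 2 = k := by
  refine ⟨fun n => if n = 0 then i else if n = 1 then j else k + (n - 2),
    fun m n hmn => ?_, by simp, by simp, by simp⟩
  simp only
  split_ifs <;> omega

/-- Compatibility with strictly increasing maps, in terms of weights. -/
def WeightCompatible (x : ℕ → G) : Prop :=
  ∀ p : ℕ → ℕ, StrictMono p → ∀ a b : ℕ →₀ ℕ,
    Finsupp.linearCombination ℕ x a ≤ Finsupp.linearCombination ℕ x b →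
    Finsupp.linearCombination ℕ x (Finsupp.mapDomain p a) ≤
      Finsupp.linearCombination ℕ x (Finsupp.mapDomain p b)

omit [IsOrderedAddMonoid G] in
lemma WeightCompatible.le_iff (hc : WeightCompatible x)
    (hx : Function.Injective (Finsupp.linearCombination ℕ x)) {p : ℕ → ℕ} (hp : StrictMono p)
    (a b : ℕ →₀ ℕ) :
    Finsupp.linearCombination ℕ x (Finsupp.mapDomain p a) ≤
      Finsupp.linearCombination ℕ x (Finsupp.mapDomain p b) ↔
    Finsupp.linearCombination ℕ x a ≤ Finsupp.linearCombination ℕ x b := by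
  refine ⟨fun h => ?_, hc p hp a b⟩
  rcases le_total (Finsupp.linearCombination ℕ x a) (Finsupp.linearCombination ℕ x b) with h' | h'
  · exact h'
  · have := Finsupp.mapDomain_injective hp.injective (hx (h.antisymm (hc p hp b a h')))
    rw [this]

lemma WeightCompatible.nonneg_iff (hc : WeightCompatible x)
    (hx : Function.Injective (Finsupp.linearCombination ℕ x)) {i j k : ℕ}
    (hij : i < j) (hjk : j < k) (α β γ : ℤ) :
    0 ≤ α • x i + β • x j + γ • x k ↔ 0 ≤ α • x 0 + β • x 1 + γ • x 2 := by
  obtain ⟨p, hp, rfl, rfl, rfl⟩ := exists_strictMono_extending hij hjk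
  have key : ∀ u v w : G, 0 ≤ α • u + β • v + γ • w ↔
      (-α).toNat • u + (-β).toNat • v + (-γ).toNat • w ≤
        α.toNat • u + β.toNat • v + γ.toNat • w := by
    intro u v w
    rw [← sub_nonneg (b := (-α).toNat • u + (-β).toNat • v + (-γ).toNat • w)]
    have hz : ∀ (m : ℤ) (g : G), m • g = m.toNat • g - (-m).toNat • g := by
      intro m g
      rw [← natCast_zsmul, ← natCast_zsmul, ← sub_smul, Int.toNat_sub_toNat_neg]
    rw [hz α u, hz β v, hz γ w]
    refine iff_of_eq (congrArg _ ?_)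
    abel
  have := hc.le_iff hx hp
    (Finsupp.single 0 (-α).toNat + Finsupp.single 1 (-β).toNat + Finsupp.single 2 (-γ).toNat)
    (Finsupp.single 0 α.toNat + Finsupp.single 1 β.toNat + Finsupp.single 2 γ.toNat)
  simp only [Finsupp.mapDomain_add, Finsupp.mapDomain_single, map_add,
    Finsupp.linearCombination_single] at this
  rw [key, key, this]

lemma injective_of_linearCombination {G : Type*} [AddCommGroup G] {x : ℕ → G}
    (hx : Function.Injective (Finsupp.linearCombination ℕ x)) : Function.Injective x := by
  intro i j hij
  have : Finsupp.single i 1 = Finsupp.single j 1 := hx (by simpa using hij)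
  exact Finsupp.single_left_injective one_ne_zero this

lemma WeightCompatible.monotonic (hc : WeightCompatible x)
    (hx : Function.Injective (Finsupp.linearCombination ℕ x)) : Monotonic x := by
  have hinj := injective_of_linearCombination hx
  rcases le_total (x 0) (x 1) with h | h
  · refine .inl fun i j hij => lt_of_le_of_ne ?_ (hinj.ne hij.ne)
    have := (hc.nonneg_iff hx hij (Nat.lt_succ_self j) (-1) 1 0).2 (by simpa using h)
    simpa using this
  · refine .inr fun i j hij => lt_of_le_of_ne ?_ (hinj.ne hij.ne')
    have := (hc.nonneg_iff hx hij (Nat.lt_succ_self j) 1 (-1) 0).2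
      (by simpa [← sub_eq_add_neg] using h)
    simpa [← sub_eq_add_neg] using this

lemma WeightCompatible.signInvariant (hc : WeightCompatible x)
    (hx : Function.Injective (Finsupp.linearCombination ℕ x)) : SignInvariant x := by
  intro α β γ i j k i' j' k' hij hjk hij' hjk' h
  rcases hc.monotonic hx with hm | hm
  · rw [hm.lt_iff_lt] at *
    rwa [hc.nonneg_iff hx hij' hjk', ← hc.nonneg_iff hx hij hjk]
  · rw [hm.lt_iff_gt] at *
    have hswap : ∀ u v w : G, α • u + β • v + γ • w = γ • w + β • v + α • u := fun _ _ _ => by abel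
    rw [hswap] at h ⊢
    rwa [hc.nonneg_iff hx hjk' hij', ← hc.nonneg_iff hx hjk hij]

lemma WeightCompatible.signInvariant_pair (hc : WeightCompatible x)
    (hx : Function.Injective (Finsupp.linearCombination ℕ x)) (α β : ℤ) {i j i' j' : ℕ}
    (hij : x i < x j) (hij' : x i' < x j') (h : 0 ≤ α • x i + β • x j) :
    0 ≤ α • x i' + β • x j' := by
  rcases hc.monotonic hx with hm | hm
  · rw [hm.lt_iff_lt] at *
    have := (hc.nonneg_iff hx hij (Nat.lt_succ_self j) α β 0).1 (by simpa using h)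
    simpa using (hc.nonneg_iff hx hij' (Nat.lt_succ_self j') α β 0).2 this
  · rw [hm.lt_iff_gt] at *
    have := (hc.nonneg_iff hx hij (Nat.lt_succ_self i) β α 0).1 (by simpa [add_comm] using h)
    simpa [add_comm] using (hc.nonneg_iff hx hij' (Nat.lt_succ_self i') β α 0).2 this

lemma Monotonic.exists_chain {G : Type*} [LinearOrder G] {x : ℕ → G} (hm : Monotonic x) :
    ∃ i j k l, x i < x j ∧ x j < x k ∧ x k < x l := by
  rcases hm with hm | hm
  · exact ⟨0, 1, 2, 3, hm (by simp), hm (by simp), hm (by simp)⟩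
  · exact ⟨3, 2, 1, 0, hm (by simp), hm (by simp), hm (by simp)⟩

/-- Either each variable dominates all multiples of the smaller ones, or all variables agree
up to infinitesimals. -/
lemma WeightCompatible.dominates_or_infinitesimal (hc : WeightCompatible x)
    (hx : Function.Injective (Finsupp.linearCombination ℕ x)) (hpos : ∀ i, 0 < x i) :
    (∀ i j, x i < x j → ∀ n : ℕ, n • x i < x j) ∨
      ∀ i j k, ∀ n : ℕ, n • |x i - x j| < x k := by
  refine or_iff_not_imp_left.2 fun hnot => ?_
  push Not at hnot
  obtain ⟨i₀, j₀, hij₀, N, hN₀⟩ := hnot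
  have hN : ∀ i j, x i < x j → x j ≤ N • x i := fun i j hij => by
    have := hc.signInvariant_pair hx N (-1) hij₀ hij (by simpa [← sub_eq_add_neg] using hN₀)
    simpa [← sub_eq_add_neg] using this
  have hgap : ∀ i j, x i < x j → ∀ m : ℕ, m • (x j - x i) < x i := by
    by_contra! hcon
    obtain ⟨i₁, j₁, hij₁, m, hm₁⟩ := hcon
    have hpair : ∀ (q : ℕ) (i j i' j' : ℕ), x i < x j → x i' < x j' →
        q • x i ≤ m • (x j - x i) → q • x i' ≤ m • (x j' - x i') := by
      intro q i j i' j' hij hij' h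
      have e : ∀ u v : G, m • (v - u) - q • u = (-(q + m : ℤ)) • u + (m : ℤ) • v := by
        intro u v; module
      rw [← sub_nonneg, e] at h ⊢
      exact hc.signInvariant_pair hx _ _ hij hij' h
    have hall : ∀ q : ℕ, ∀ i j, x i < x j → q • x i ≤ m • (x j - x i) := by
      intro q
      induction q with
      | zero => intro i j hij; simpa using nsmul_nonneg (sub_nonneg.2 hij.le) m
      | succ q ih =>
        intro i j hij
        obtain ⟨r, s, t, -, hrs, hst, -⟩ := (hc.monotonic hx).exists_chain
        refine hpair (q + 1) r t i j (hrs.trans hst) hij ?_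
        have h1 : x s ≤ m • (x t - x s) := by
          simpa using hpair 1 i₁ j₁ s t hij₁ hst (by simpa using hm₁)
        calc (q + 1) • x r = q • x r + x r := succ_nsmul _ _
          _ ≤ m • (x s - x r) + m • (x t - x s) := add_le_add (ih r s hrs) (hrs.le.trans h1)
          _ = m • (x t - x r) := by module
    have h1 := hall (m * N + 1) i₁ j₁ hij₁
    have h2 : m • (x j₁ - x i₁) ≤ m • (N • x i₁) :=
      nsmul_le_nsmul_right ((sub_le_self _ (hpos i₁).le).trans (hN _ _ hij₁)) m
    have h3 := h1.trans h2
    rw [succ_nsmul, mul_comm, mul_nsmul] at h3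
    have := hpos i₁
    exact absurd h3 (by simpa using this)
  have hbase : ∀ i k, x i ≤ (N + 1) • x k := fun i k => by
    rcases le_or_gt (x i) (x k) with h | h
    · exact h.trans (le_self_nsmul (hpos k).le (by omega))
    · exact (hN k i h).trans (nsmul_le_nsmul_left (hpos k).le (by omega))
  have hlt : ∀ i j k, x i < x j → ∀ n : ℕ, n • (x j - x i) < x k := fun i j k hij n => by
    refine lt_of_nsmul_lt_nsmul_right (N + 1) (lt_of_lt_of_le ?_ (hbase i k))
    rw [← mul_nsmul]
    exact hgap i j hij _
  intro i j k n
  rcases lt_trichotomy (x i) (x j) with h | h | h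
  · rw [abs_sub_comm, abs_of_pos (sub_pos.2 h)]
    exact hlt i j k h n
  · simpa [h] using hpos k
  · rw [abs_of_pos (sub_pos.2 h)]
    exact hlt j i k h n

/-- Of two adjacent gaps between variables, either always the upper one dominates all multiples of
the lower one, or the other way round. -/
lemma WeightCompatible.gap_dichotomy (hc : WeightCompatible x)
    (hx : Function.Injective (Finsupp.linearCombination ℕ x)) :
    (∀ i j k, x i < x j → x j < x k → ∀ n : ℕ, n • (x j - x i) < x k - x j) ∨
      ∀ i j k, x i < x j → x j < x k → ∀ n : ℕ, n • (x k - x j) < x j - x i := by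
  refine or_iff_not_imp_left.2 fun hnot => ?_
  push Not at hnot
  obtain ⟨i₀, j₀, k₀, hij₀, hjk₀, n, hn⟩ := hnot
  by_contra! hcon
  obtain ⟨i₁, j₁, k₁, hij₁, hjk₁, m, hm⟩ := hcon
  have htriple : ∀ (q : ℕ) (i j k i' j' k' : ℕ), x i < x j → x j < x k → x i' < x j' →
      x j' < x k' → q • (x j - x i) ≤ m • (x k - x j) →
      q • (x j' - x i') ≤ m • (x k' - x j') := by
    intro q i j k i' j' k' hij hjk hij' hjk' h
    have e : ∀ u v w : G, m • (w - v) - q • (v - u) =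
        (q : ℤ) • u + (-(q + m : ℤ)) • v + (m : ℤ) • w := by
      intro u v w; module
    rw [← sub_nonneg, e] at h ⊢
    exact hc.signInvariant hx _ _ _ _ _ _ _ _ _ hij hjk hij' hjk' h
  have hall : ∀ q : ℕ, ∀ i j k, x i < x j → x j < x k →
      q • (x j - x i) ≤ m • (x k - x j) := by
    intro q
    induction q with
    | zero => intro i j k _ hjk; simpa using nsmul_nonneg (sub_nonneg.2 hjk.le) m
    | succ q ih =>
      intro i j k hij hjk
      obtain ⟨r, s, t, u, hrs, hst, htu⟩ := (hc.monotonic hx).exists_chain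
      refine htriple (q + 1) r s u i j k hrs (hst.trans htu) hij hjk ?_
      have h1 : x t - x r ≤ m • (x u - x t) := by
        simpa using htriple 1 i₁ j₁ k₁ r t u hij₁ hjk₁ (hrs.trans hst) htu (by simpa using hm)
      have h2 : x s - x r ≤ x t - x r := sub_le_sub_right hst.le _
      calc (q + 1) • (x s - x r) = q • (x s - x r) + (x s - x r) := succ_nsmul _ _
        _ ≤ m • (x t - x s) + m • (x u - x t) := add_le_add (ih r s t hrs hst) (h2.trans h1)
        _ = m • (x u - x s) := by module
  have h1 := hall (m * n + 1) i₀ j₀ k₀ hij₀ hjk₀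
  have h2 := h1.trans (nsmul_le_nsmul_right hn m)
  rw [succ_nsmul, mul_comm, mul_nsmul] at h2
  exact absurd h2 (by simpa using hij₀)

end Dichotomies

lemma strict_mem_of_incCompatible (T : TermOrder ℕ) (hT : IncCompatible T) :
    (fun a b => T.le a b ∧ a ≠ b) ∈
      ({oMin, oDegMin, oRevDegMinInv, oMax, oDegMax, oRevDegMaxInv} :
        Set ((ℕ →₀ ℕ) → (ℕ →₀ ℕ) → Prop)) := by
  obtain ⟨G, _, _, _, x, hle⟩ := T.exists_weights
  have hx : Function.Injective (Finsupp.linearCombination ℕ x) := fun a b h =>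
    T.antisymm a b ((hle a b).2 h.le) ((hle b a).2 h.ge)
  have hc : WeightCompatible x := fun p hp a b h => (hle _ _).1 (hT p hp a b ((hle a b).2 h))
  have hinj := injective_of_linearCombination hx
  have hpos : ∀ i, 0 < x i := fun i => by
    refine lt_of_le_of_ne ?_ fun h => ?_
    · simpa using (hle 0 (Finsupp.single i 1)).1 (T.zero_le _)
    · have : (0 : ℕ →₀ ℕ) = Finsupp.single i 1 := hx (by simpa using h)
      simpa using this.symm
  have hstrict : (fun a b => T.le a b ∧ a ≠ b) = fun a b =>
      Finsupp.linearCombination ℕ x a < Finsupp.linearCombination ℕ x b := by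
    ext a b
    rw [lt_iff_le_and_ne, hle, hx.ne_iff]
  have heq : ∀ L, IsIncOrder L → (∀ a b, L a b →
      Finsupp.linearCombination ℕ x a < Finsupp.linearCombination ℕ x b) →
      (fun a b => T.le a b ∧ a ≠ b) = L := fun L hL h => by
    rw [hstrict]
    exact hL.eq_of_imp (fun a => lt_irrefl _) (fun a b h => lt_asymm h) h
  have heqdeg : ∀ L, IsIncOrder L →
      (∀ i j k, ∀ n : ℕ, n • |x i - x j| < x k) → (∀ a b, degOf a = degOf b → L a b →
      Finsupp.linearCombination ℕ x a < Finsupp.linearCombination ℕ x b) →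
      (fun a b => T.le a b ∧ a ≠ b) = degThen L := fun L hL hinf h => by
    refine heq _ hL.degThen ?_
    rintro a b (hab | ⟨hab, hL⟩)
    · exact linearCombination_lt_of_degOf_lt hpos hinf hab
    · exact h a b hab hL
  simp only [Set.mem_insert_iff, Set.mem_singleton_iff]
  rcases hc.monotonic hx with hm | hm
  · have htop := topLt_of_strictMono hm
    have hbot : topLt (-x) = minLt := topLt_of_strictAnti fun i j h => neg_lt_neg (hm h)
    rcases hc.dominates_or_infinitesimal hx hpos with h | h
    · refine .inr <| .inr <| .inr <| .inl <| heq _ isIncOrder_maxLt fun a b hab => ?_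
      exact linearCombination_lt_of_topLt hinj hpos h (htop ▸ hab)
    rcases hc.gap_dichotomy hx with h' | h'
    · refine .inr <| .inr <| .inr <| .inr <| .inl <|
        heqdeg _ isIncOrder_maxLt h fun a b hdeg hab => ?_
      exact linearCombination_lt_of_degOf_eq_of_topLt hinj h' hdeg (htop ▸ hab)
    · refine .inr <| .inr <| .inl <| heqdeg _ isIncOrder_minLt.swap h fun a b hdeg hab => ?_
      exact linearCombination_lt_of_degOf_eq_of_topLt_neg hinj h' hdeg (hbot ▸ hab)
  · have htop := topLt_of_strictAnti hm
    have hbot : topLt (-x) = maxLt := topLt_of_strictMono fun i j h => neg_lt_neg (hm h)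
    rcases hc.dominates_or_infinitesimal hx hpos with h | h
    · refine .inl <| heq _ isIncOrder_minLt fun a b hab => ?_
      exact linearCombination_lt_of_topLt hinj hpos h (htop ▸ hab)
    rcases hc.gap_dichotomy hx with h' | h'
    · refine .inr <| .inl <| heqdeg _ isIncOrder_minLt h fun a b hdeg hab => ?_
      exact linearCombination_lt_of_degOf_eq_of_topLt hinj h' hdeg (htop ▸ hab)
    · refine .inr <| .inr <| .inr <| .inr <| .inr <|
        heqdeg _ isIncOrder_maxLt.swap h fun a b hdeg hab => ?_
      exact linearCombination_lt_of_degOf_eq_of_topLt_neg hinj h' hdeg (hbot ▸ hab)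

lemma IsIncOrder.zero_lt_of_not_lt_zero {L : (ℕ →₀ ℕ) → (ℕ →₀ ℕ) → Prop} (hL : IsIncOrder L)
    (h : ∀ a, ¬ L a 0) (a : ℕ →₀ ℕ) (ha : a ≠ 0) : L 0 a :=
  (hL.total a 0 ha).resolve_left (h a)

lemma exists_termOrder_of_mem {r : (ℕ →₀ ℕ) → (ℕ →₀ ℕ) → Prop}
    (hr : r ∈ ({oMin, oDegMin, oRevDegMinInv, oMax, oDegMax, oRevDegMaxInv} :
        Set ((ℕ →₀ ℕ) → (ℕ →₀ ℕ) → Prop))) :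
    ∃ T : TermOrder ℕ, IncCompatible T ∧ (fun a b => T.le a b ∧ a ≠ b) = r := by
  rcases hr with rfl | rfl | rfl | rfl | rfl | rfl
  · exact isIncOrder_minLt.exists_termOrder
      (IsIncOrder.zero_lt_of_not_lt_zero isIncOrder_minLt fun a => by simp [minLt])
  · exact isIncOrder_minLt.exists_termOrder_degThen
  · exact isIncOrder_minLt.swap.exists_termOrder_degThen
  · exact isIncOrder_maxLt.exists_termOrder
      (IsIncOrder.zero_lt_of_not_lt_zero isIncOrder_maxLt fun a => by simp [maxLt])
  · exact isIncOrder_maxLt.exists_termOrder_degThen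
  · exact isIncOrder_maxLt.swap.exists_termOrder_degThen

lemma pairwise_ne_incCompatible_orders :
    List.Pairwise (· ≠ ·) [oMin, oDegMin, oRevDegMinInv, oMax, oDegMax, oRevDegMaxInv] := by
  let e : ℕ → (ℕ →₀ ℕ) := fun i => Finsupp.single i 1
  have test : ∀ r r' : (ℕ →₀ ℕ) → (ℕ →₀ ℕ) → Prop, r = r' →
      (r (e 0) (e 1) ↔ r' (e 0) (e 1)) ∧ (r (e 0) (e 1 + e 1) ↔ r' (e 0) (e 1 + e 1)) ∧
      (r (e 0 + e 0) (e 1) ↔ r' (e 0 + e 0) (e 1)) ∧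
      (r (e 0 + e 2) (e 1 + e 1) ↔ r' (e 0 + e 2) (e 1 + e 1)) := by
    rintro r _ rfl
    simp
  have hdeg : ∀ i, degOf (e i) = 1 := fun i => by simp [degOf, e]
  have min₁ : minLt (e 1) (e 0) := ⟨0, by simp [e], by simp⟩
  have min₂ : minLt (e 1 + e 1) (e 0) := ⟨0, by simp [e], by simp⟩
  have min₃ : minLt (e 1) (e 0 + e 0) := ⟨0, by simp [e], by simp⟩
  have min₄ : minLt (e 1 + e 1) (e 0 + e 2) := ⟨0, by simp [e], by simp⟩
  have max₁ : maxLt (e 0) (e 1) := ⟨1, by simp [e], fun k hk => by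
    simp [e, Finsupp.single_apply]; split_ifs <;> omega⟩
  have max₂ : maxLt (e 0 + e 0) (e 1) := ⟨1, by simp [e], fun k hk => by
    simp [e, Finsupp.single_apply]; split_ifs <;> omega⟩
  have max₃ : maxLt (e 1 + e 1) (e 0 + e 2) := ⟨2, by simp [e], fun k hk => by
    simp [e, Finsupp.single_apply]; split_ifs <;> omega⟩
  have min₁' := isIncOrder_minLt.asymm min₁
  have min₂' := isIncOrder_minLt.asymm min₂
  have min₃' := isIncOrder_minLt.asymm min₃
  have min₄' := isIncOrder_minLt.asymm min₄
  have max₁' := isIncOrder_maxLt.asymm max₁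
  have max₃' := isIncOrder_maxLt.asymm max₃
  simp only [List.pairwise_cons, List.mem_cons, List.not_mem_nil, or_false, forall_eq_or_imp,
    forall_eq, List.Pairwise.nil, and_true, false_imp_iff, implies_true]
  refine ⟨⟨?_, ?_, ?_, ?_, ?_⟩, ⟨?_, ?_, ?_, ?_⟩, ⟨?_, ?_, ?_⟩, ⟨?_, ?_⟩, ?_⟩ <;>
  · intro h
    have := test _ _ h
    simp [oMin, oDegMin, oRevDegMinInv, oMax, oDegMax, oRevDegMaxInv, degOf_add, *] at this

/-- **Theorem (Statement 18).** For `c = 1` there are exactly six `Inc(ℕ)`-compatible term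
orders on `R`, namely `≺_min`, `≺_deg-min`, `(≺_revdeg-min)⁻¹`, `≺_{max,1}`,
`≺_{deg-max,2}`, `(≺_{revdeg-max,2})⁻¹`. -/
theorem incCompatible_termOrders_classification :
    {r : (ℕ →₀ ℕ) → (ℕ →₀ ℕ) → Prop |
        ∃ T : TermOrder ℕ, IncCompatible T ∧ (fun a b => T.le a b ∧ a ≠ b) = r} =
      {oMin, oDegMin, oRevDegMinInv, oMax, oDegMax, oRevDegMaxInv} ∧
    List.Pairwise (· ≠ ·) [oMin, oDegMin, oRevDegMinInv, oMax, oDegMax, oRevDegMaxInv] := by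
  refine ⟨Set.Subset.antisymm ?_ fun r hr => exists_termOrder_of_mem hr,
    pairwise_ne_incCompatible_orders⟩
  rintro _ ⟨T, hT, rfl⟩
  exact strict_mem_of_incCompatible T hT
end

section
/- Let c = 1 and let J := ⟨Inc(ℕ)·(x₁²x₂ + x₁x₂²)⟩_R be the ideal of R generated by the Inc(ℕ)-orbit of x₁²x₂ + x₁x₂². Then J is Inc(ℕ)-invariant and has infinitely many pairwise distinct initial ideals in_⪯(J) as ⪯ ranges over arbitrary (not necessarily Inc(ℕ)-compatible) term orders on R. In particular, for n < n' the monomial x₁²x_{n'} lies in in_{⪯_n}(J) but not in in_{⪯_{n'}}(J), where ⪯_n is the term order defined by x_{σ_n(1)}^{a₁}···x_{σ_n(k)}^{a_k} ≺_n x_{σ_n(1)}^{b₁}···x_{σ_n(k)}^{b_k} ⇔ a_i < b_i for i = min{j | a_j ≠ b_j}, with σ_n the permutation of ℕ given by σ_n(j) = n+1−j for j ≤ n and σ_n(j) = j for j > n. -/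
open MvPolynomial

/-- `a` is the exponent vector of the leading monomial of `f` with respect to the strict
relation `r` on monomials. -/
def IsLeadMon {K : Type*} [Field K] (r : (ℕ →₀ ℕ) → (ℕ →₀ ℕ) → Prop)
    (f : MvPolynomial ℕ K) (a : ℕ →₀ ℕ) : Prop :=
  a ∈ f.support ∧ ∀ b ∈ f.support, b ≠ a → r b a

/-- The initial ideal of `J` with respect to the strict relation `r`: the ideal of `R`
generated by the leading monomials of the nonzero elements of `J`. -/
noncomputable def initIdeal (K : Type*) [Field K] (r : (ℕ →₀ ℕ) → (ℕ →₀ ℕ) → Prop)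
    (J : Ideal (MvPolynomial ℕ K)) : Ideal (MvPolynomial ℕ K) :=
  Ideal.span {g | ∃ f ∈ J, f ≠ 0 ∧ ∃ a, IsLeadMon r f a ∧ g = monomial a (1 : K)}

/-- The ideal `J = ⟨Inc(ℕ) · (x₁²x₂ + x₁x₂²)⟩_R` generated by the `Inc(ℕ)`-orbit of
`x₁²x₂ + x₁x₂²` (variables are indexed `0`-based, so the polynomial is `x₀²x₁ + x₀x₁²`). -/
noncomputable def bigJ (K : Type*) [Field K] : Ideal (MvPolynomial ℕ K) :=
  Ideal.span {g | ∃ p : ℕ → ℕ, StrictMono p ∧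
    g = rename p (X 0 ^ 2 * X 1 + X 0 * X 1 ^ 2 : MvPolynomial ℕ K)}

/-- The permutation `σ_n` of the (`1`-based) natural numbers, `σ_n(j) = n + 1 − j` for
`j ≤ n` and `σ_n(j) = j` for `j > n`; rendered `0`-based it reverses the first `n`
indices. -/
def sigN (n : ℕ) : ℕ → ℕ := fun j => if j < n then n - 1 - j else j

/-- The (strict part of the) term order `⪯_n`: lexicographic comparison of the exponents of
the variables in the order `x_{σ_n(1)}, x_{σ_n(2)}, ...`. -/
def ordLt (n : ℕ) (a b : ℕ →₀ ℕ) : Prop :=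
  ∃ k : ℕ, a (sigN n k) < b (sigN n k) ∧ ∀ k' < k, a (sigN n k') = b (sigN n k')

theorem sigN_sigN (n j : ℕ) : sigN n (sigN n j) = j := by
  unfold sigN
  split_ifs <;> omega

theorem sigN_zero {n : ℕ} (hn : 1 ≤ n) : sigN n 0 = n - 1 := by
  simp only [sigN]
  split_ifs <;> omega

theorem ordLt_trichotomous (n : ℕ) {a b : ℕ →₀ ℕ} (h : a ≠ b) : ordLt n a b ∨ ordLt n b a := by
  classical
  have hex : ∃ k, a (sigN n k) ≠ b (sigN n k) := by
    by_contra! hall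
    exact h (Finsupp.ext fun j => by simpa [sigN_sigN] using hall (sigN n j))
  have hmin : ∀ k < Nat.find hex, a (sigN n k) = b (sigN n k) := fun k hk => by
    simpa using Nat.find_min hex hk
  rcases lt_or_gt_of_ne (Nat.find_spec hex) with h1 | h1
  · exact Or.inl ⟨_, h1, hmin⟩
  · exact Or.inr ⟨_, h1, fun k hk => (hmin k hk).symm⟩

theorem ordLt_trans (n : ℕ) {a b c : ℕ →₀ ℕ} (hab : ordLt n a b) (hbc : ordLt n b c) :
    ordLt n a c := by
  obtain ⟨k, hk, hk'⟩ := hab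
  obtain ⟨l, hl, hl'⟩ := hbc
  rcases lt_trichotomy k l with h | rfl | h
  · exact ⟨k, hl' k h ▸ hk, fun j hj => (hk' j hj).trans (hl' j (hj.trans h))⟩
  · exact ⟨k, hk.trans hl, fun j hj => (hk' j hj).trans (hl' j hj)⟩
  · exact ⟨l, (hk' l h).symm ▸ hl, fun j hj => (hk' j (hj.trans h)).trans (hl' j hj)⟩

theorem ordLt_irrefl (n : ℕ) (a : ℕ →₀ ℕ) : ¬ ordLt n a a := fun ⟨_, h, _⟩ => h.false

theorem ordLt_add_right (n : ℕ) {a b : ℕ →₀ ℕ} (c : ℕ →₀ ℕ) (h : ordLt n a b) :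
    ordLt n (a + c) (b + c) := by
  obtain ⟨k, hk, hk'⟩ := h
  exact ⟨k, by simpa using hk, fun j hj => by simpa using hk' j hj⟩

theorem not_ordLt_zero (n : ℕ) (a : ℕ →₀ ℕ) : ¬ ordLt n a 0 := fun ⟨_, h, _⟩ => by simp at h

/-- The term order whose strict part is `ordLt n`. -/
def ordLtTermOrder (n : ℕ) : TermOrder ℕ where
  le a b := a = b ∨ ordLt n a b
  refl _ := Or.inl rfl
  trans := by
    rintro a b c (rfl | hab) (rfl | hbc)
    · exact Or.inl rfl
    · exact Or.inr hbc
    · exact Or.inr hab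
    · exact Or.inr (ordLt_trans n hab hbc)
  antisymm := by
    rintro a b (h | hab) (h' | hba)
    · exact h
    · exact h
    · exact h'.symm
    · exact absurd (ordLt_trans n hab hba) (ordLt_irrefl n a)
  total a b := by
    by_cases h : a = b
    · exact Or.inl (Or.inl h)
    · exact (ordLt_trichotomous n h).imp Or.inr Or.inr
  add_right := by
    rintro a b c (rfl | h)
    · exact Or.inl rfl
    · exact Or.inr (ordLt_add_right n c h)
  zero_le a := by
    by_cases h : 0 = a
    · exact Or.inl h
    · exact Or.inr ((ordLt_trichotomous n h).resolve_right (not_ordLt_zero n a))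

theorem ordLtTermOrder_strict (n : ℕ) :
    (fun a b => (ordLtTermOrder n).le a b ∧ a ≠ b) = ordLt n := by
  funext a b
  refine propext ⟨fun ⟨h, hne⟩ => h.resolve_left hne, fun h => ⟨Or.inr h, ?_⟩⟩
  rintro rfl
  exact ordLt_irrefl n a h

theorem rename_mem_bigJ (K : Type*) [Field K] {p : ℕ → ℕ} (hp : StrictMono p)
    {f : MvPolynomial ℕ K} (hf : f ∈ bigJ K) : rename p f ∈ bigJ K := by
  suffices bigJ K ≤ (bigJ K).comap (rename p : MvPolynomial ℕ K →ₐ[K] MvPolynomial ℕ K) from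
    this hf
  refine Ideal.span_le.2 ?_
  rintro _ ⟨q, hq, rfl⟩
  refine Ideal.subset_span ⟨p ∘ q, hp.comp hq, ?_⟩
  exact rename_rename q p _

theorem rename_generator (K : Type*) [Field K] (p : ℕ → ℕ) :
    rename p (X 0 ^ 2 * X 1 + X 0 * X 1 ^ 2 : MvPolynomial ℕ K) =
      monomial (Finsupp.single (p 0) 2 + Finsupp.single (p 1) 1) 1 +
        monomial (Finsupp.single (p 1) 2 + Finsupp.single (p 0) 1) 1 := by
  simp only [map_add, map_mul, map_pow, rename_X]
  simp only [X_pow_eq_monomial]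
  simp only [X, monomial_mul, mul_one]
  rw [add_comm (Finsupp.single (p 0) 1)]

theorem single_two_add_single_one_inj {i j k l : ℕ} (hij : i ≠ j) (hkl : k ≠ l) :
    (Finsupp.single i 2 + Finsupp.single j 1 : ℕ →₀ ℕ) =
      Finsupp.single k 2 + Finsupp.single l 1 ↔ i = k ∧ j = l := by
  refine ⟨fun h => ?_, by rintro ⟨rfl, rfl⟩; rfl⟩
  have hi := DFunLike.congr_fun h i
  have hj := DFunLike.congr_fun h j
  simp only [Finsupp.add_apply, Finsupp.single_apply] at hi hj
  grind

theorem degree_single_two_add_single_one (i j : ℕ) :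
    (Finsupp.single i 2 + Finsupp.single j 1 : ℕ →₀ ℕ).degree = 3 := by
  simp

theorem coeff_eq_zero_of_mem_bigJ (K : Type*) [Field K] {f : MvPolynomial ℕ K}
    (hf : f ∈ bigJ K) : ∀ a : ℕ →₀ ℕ, a.degree < 3 → coeff a f = 0 := by
  classical
  refine Submodule.span_induction ?_ (by simp) ?_ ?_ hf
  · rintro _ ⟨p, -, rfl⟩ a ha
    rw [rename_generator, coeff_add, coeff_monomial, coeff_monomial, if_neg, if_neg, add_zero]
    all_goals
      rintro rfl
      rw [degree_single_two_add_single_one] at ha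
      exact ha.false
  · intro f g _ _ hf hg a ha
    rw [coeff_add, hf a ha, hg a ha, add_zero]
  · intro r f _ hf a ha
    rw [smul_eq_mul, coeff_mul]
    refine Finset.sum_eq_zero fun x hx => ?_
    rw [Finset.HasAntidiagonal.mem_antidiagonal] at hx
    have : x.1.degree + x.2.degree = a.degree := by rw [← hx, map_add]
    rw [hf x.2 (by omega), mul_zero]

theorem coeff_mul_of_degree_eq_three {K : Type*} [Field K] (r : MvPolynomial ℕ K)
    {f : MvPolynomial ℕ K} (hf : ∀ a : ℕ →₀ ℕ, a.degree < 3 → coeff a f = 0)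
    {a : ℕ →₀ ℕ} (ha : a.degree = 3) : coeff a (r * f) = coeff 0 r * coeff a f := by
  classical
  rw [coeff_mul, Finset.sum_eq_single (0, a)]
  · intro x hx hne
    rw [Finset.HasAntidiagonal.mem_antidiagonal] at hx
    have hdeg : x.1.degree + x.2.degree = a.degree := by rw [← hx, map_add]
    have h1 : x.1.degree ≠ 0 := by
      rw [Ne, Finsupp.degree_eq_zero_iff]
      intro h0
      exact hne (Prod.ext h0 (by simpa [h0] using hx))
    rw [hf x.2 (by omega), mul_zero]
  · simp

theorem coeff_swap_of_mem_bigJ (K : Type*) [Field K] {f : MvPolynomial ℕ K}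
    (hf : f ∈ bigJ K) {k l : ℕ} (hkl : k ≠ l) :
    coeff (Finsupp.single k 2 + Finsupp.single l 1) f =
      coeff (Finsupp.single l 2 + Finsupp.single k 1) f := by
  classical
  refine Submodule.span_induction ?_ (by simp) ?_ ?_ hf
  · rintro _ ⟨p, hp, rfl⟩
    have h01 : p 0 ≠ p 1 := hp.injective.ne zero_ne_one
    simp only [rename_generator, coeff_add, coeff_monomial,
      single_two_add_single_one_inj h01 hkl, single_two_add_single_one_inj h01.symm hkl,
      single_two_add_single_one_inj h01 hkl.symm, single_two_add_single_one_inj h01.symm hkl.symm]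
    rw [add_comm]
    simp only [and_comm]
  · intro f g _ _ hf hg
    rw [coeff_add, coeff_add, hf, hg]
  · intro r f hfJ hf
    have h0 := coeff_eq_zero_of_mem_bigJ K hfJ
    rw [smul_eq_mul, coeff_mul_of_degree_eq_three r h0 (degree_single_two_add_single_one k l),
      coeff_mul_of_degree_eq_three r h0 (degree_single_two_add_single_one l k), hf]

theorem monomial_mem_initIdeal_iff (K : Type*) [Field K] (r : (ℕ →₀ ℕ) → (ℕ →₀ ℕ) → Prop)
    (J : Ideal (MvPolynomial ℕ K)) (m : ℕ →₀ ℕ) :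
    monomial m (1 : K) ∈ initIdeal K r J ↔ ∃ f ∈ J, ∃ a ≤ m, IsLeadMon r f a := by
  have h : initIdeal K r J =
      Ideal.span ((fun a => monomial a (1 : K)) '' {a | ∃ f ∈ J, IsLeadMon r f a}) := by
    refine congrArg Ideal.span (Set.ext fun g => ⟨?_, ?_⟩)
    · rintro ⟨f, hf, -, a, ha, rfl⟩
      exact ⟨a, ⟨f, hf, ha⟩, rfl⟩
    · rintro ⟨a, ⟨f, hf, ha⟩, rfl⟩
      refine ⟨f, hf, ?_, a, ha, rfl⟩
      rintro rfl
      simpa using ha.1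
  rw [h, mem_ideal_span_monomial_image]
  classical
  simp only [support_monomial, one_ne_zero, if_false, Finset.mem_singleton, forall_eq,
    Set.mem_ofPred_eq]
  exact ⟨fun ⟨a, ⟨f, hf, ha⟩, hle⟩ => ⟨f, hf, a, hle, ha⟩,
    fun ⟨f, hf, a, hle, ha⟩ => ⟨a, ⟨f, hf, ha⟩, hle⟩⟩

theorem monomial_mem_initIdeal_bigJ (K : Type*) [Field K] {n n' : ℕ} (hn : 1 ≤ n)
    (hnn' : n < n') :
    monomial (Finsupp.single 0 2 + Finsupp.single (n' - 1) 1) (1 : K) ∈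
      initIdeal K (ordLt n) (bigJ K) := by
  classical
  have h0 : 0 ≠ n' - 1 := by omega
  have hne : (Finsupp.single 0 2 + Finsupp.single (n' - 1) 1 : ℕ →₀ ℕ) ≠
      Finsupp.single (n' - 1) 2 + Finsupp.single 0 1 := by
    rw [Ne, single_two_add_single_one_inj h0 h0.symm]
    omega
  rw [monomial_mem_initIdeal_iff]
  refine ⟨_, Ideal.subset_span ⟨fun j => (n' - 1) * j,
    strictMono_mul_left_of_pos (by omega), rfl⟩, _, le_rfl, ?_⟩
  simp only [rename_generator, mul_zero, mul_one]
  refine ⟨?_, fun b hb hba => ?_⟩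
  · rw [mem_support_iff, coeff_add, coeff_monomial, coeff_monomial, if_pos rfl, if_neg hne.symm]
    simp
  · have hb' : b = Finsupp.single (n' - 1) 2 + Finsupp.single 0 1 := by
      rw [mem_support_iff, coeff_add, coeff_monomial, coeff_monomial, if_neg hba.symm] at hb
      by_contra h
      rw [if_neg (Ne.symm h)] at hb
      simp at hb
    subst hb'
    have hs : sigN n (n - 1) = 0 := by
      rw [← sigN_zero hn, sigN_sigN]
    refine ⟨n - 1, by simp [hs, h0.symm], fun k hk => ?_⟩
    have hk0 : sigN n k = n - 1 - k := by
      simp only [sigN]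
      split_ifs <;> omega
    have h1 : n - 1 - k ≠ 0 := by omega
    have h2 : n - 1 - k ≠ n' - 1 := by omega
    rw [hk0]
    simp [h1.symm, h2.symm]

theorem monomial_notMem_initIdeal_bigJ (K : Type*) [Field K] {n : ℕ} (hn : 2 ≤ n) :
    monomial (Finsupp.single 0 2 + Finsupp.single (n - 1) 1) (1 : K) ∉
      initIdeal K (ordLt n) (bigJ K) := by
  rw [monomial_mem_initIdeal_iff]
  rintro ⟨f, hf, a, hle, ha, hlead⟩
  have h0 : 0 ≠ n - 1 := by omega
  have hadeg : 3 ≤ a.degree := by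
    by_contra! h
    exact mem_support_iff.1 ha (coeff_eq_zero_of_mem_bigJ K hf a h)
  obtain ⟨c, hc⟩ := exists_add_of_le hle
  have hsum := congrArg Finsupp.degree hc
  rw [degree_single_two_add_single_one, map_add] at hsum
  obtain rfl : c = 0 := by
    rw [← Finsupp.degree_eq_zero_iff]
    omega
  rw [add_zero] at hc
  subst hc
  rw [mem_support_iff, coeff_swap_of_mem_bigJ K hf h0] at ha
  have hne : (Finsupp.single (n - 1) 2 + Finsupp.single 0 1 : ℕ →₀ ℕ) ≠
      Finsupp.single 0 2 + Finsupp.single (n - 1) 1 := by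
    rw [Ne, single_two_add_single_one_inj h0.symm h0]
    omega
  obtain ⟨k, hk, hk'⟩ := hlead _ (mem_support_iff.2 ha) hne
  have hs : sigN n 0 = n - 1 := sigN_zero (by omega)
  rcases k.eq_zero_or_pos with rfl | hpos
  · simp [hs, h0.symm] at hk
  · have := hk' 0 hpos
    simp [hs, h0.symm] at this

/-- For `c = 1`, the ideal `J = ⟨Inc(ℕ)·(x₁²x₂ + x₁x₂²)⟩_R` is
`Inc(ℕ)`-invariant and has infinitely many pairwise distinct initial ideals with respect to
arbitrary term orders on `R`.  In particular each `⪯_n` is a term order, and for `n < n'`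
the monomial `x₁²x_{n'}` lies in `in_{⪯_n}(J)` but not in `in_{⪯_{n'}}(J)`. -/
theorem bigJ_infinitely_many_initial_ideals (K : Type*) [Field K] :
    (∀ p : ℕ → ℕ, StrictMono p → ∀ f ∈ bigJ K, rename p f ∈ bigJ K) ∧
    (∀ n : ℕ, 1 ≤ n → ∃ T : TermOrder ℕ, (fun a b => T.le a b ∧ a ≠ b) = ordLt n) ∧
    (∀ n n' : ℕ, 1 ≤ n → n < n' →
      monomial (Finsupp.single 0 2 + Finsupp.single (n' - 1) 1) (1 : K) ∈
          initIdeal K (ordLt n) (bigJ K) ∧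
        monomial (Finsupp.single 0 2 + Finsupp.single (n' - 1) 1) (1 : K) ∉
          initIdeal K (ordLt n') (bigJ K)) ∧
    {I : Ideal (MvPolynomial ℕ K) | ∃ T : TermOrder ℕ,
      initIdeal K (fun a b => T.le a b ∧ a ≠ b) (bigJ K) = I}.Infinite := by
  have hmem := fun n n' (hn : 1 ≤ n) (h : n < n') =>
    And.intro (monomial_mem_initIdeal_bigJ K hn h)
      (monomial_notMem_initIdeal_bigJ K (n := n') (by omega))
  refine ⟨fun p hp f hf => rename_mem_bigJ K hp hf,
    fun n _ => ⟨ordLtTermOrder n, ordLtTermOrder_strict n⟩, hmem, ?_⟩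
  refine Set.infinite_of_injective_forall_mem
    (f := fun n : ℕ => initIdeal K (ordLt (n + 1)) (bigJ K)) ?_
    fun n => ⟨ordLtTermOrder (n + 1), by rw [ordLtTermOrder_strict]⟩
  refine Function.Injective.of_lt_imp_ne fun n n' h heq => ?_
  obtain ⟨h1, h2⟩ := hmem (n + 1) (n' + 1) (by omega) (by omega)
  exact h2 (heq ▸ h1)
end
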